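/- Let F = (A, R) be an AF and A_F = ⟨T, F ∪ I ∪ {i_s}⟩ its AF-database. Then for every S ⊆ A: S is semi-stable in F if and only if S_T is a maximally covering repair of A_F with respect to the range attributes X_r. -/

import Mathlib

open scoped Classical

universe u

/-- A dependency (functional or inclusion) over an attribute type `α`.
`fd X Y` is the functional dependency `X → Y`; `id X Y` is the inclusion dependency `X ⊆ Y`. -/
inductive Dep (α : Type u) : Type u
  | fd (X Y : List α) : Dep α
  | id (X Y : List α) : Dep α

/-- Satisfaction of a dependency by a set `P` of tuples; tuples are identified by
elements of `ι`, and `val t x` is the value taken by tuple `t` at attribute `x`. -/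
def satDep {ι α V : Type*} (val : ι → α → V) (P : Set ι) : Dep α → Prop
  | Dep.fd X Y => ∀ s ∈ P, ∀ t ∈ P, X.map (val s) = X.map (val t) → Y.map (val s) = Y.map (val t)
  | Dep.id X Y => ∀ s ∈ P, ∃ t ∈ P, X.map (val s) = Y.map (val t)

/-- `P` is a repair of the database instance `⟨T, B⟩`: `P ⊆ T` and `P` satisfies
every dependency in `B`. -/
def IsRepair {ι α V : Type*} (val : ι → α → V) (T : Set ι) (B : Set (Dep α)) (P : Set ι) : Prop :=
  P ⊆ T ∧ ∀ d ∈ B, satDep val P d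

/-- `P` is a maximal repair of `⟨T, B⟩`: a repair such that no repair strictly contains it. -/
def IsMaximalRepair {ι α V : Type*} (val : ι → α → V) (T : Set ι) (B : Set (Dep α))
    (P : Set ι) : Prop :=
  IsRepair val T B P ∧ ∀ P' : Set ι, IsRepair val T B P' → ¬ P ⊂ P'

/-- `supp(X ⊆ Y, s)`: the set of tuples of `T` supporting `s` for the inclusion
dependency `X ⊆ Y`. -/
def suppOf {ι α V : Type*} (val : ι → α → V) (T : Set ι) (X Y : List α) (s : ι) : Set ι :=
  {t ∈ T | Y.map (val t) = X.map (val s)}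

/-- `dom(P[X])`: the set of values taken by the tuples of `P` on the attributes in `X`. -/
def domOn {ι α V : Type*} (val : ι → α → V) (P : Set ι) (X : Set α) : Set V :=
  {v | ∃ s ∈ P, ∃ x ∈ X, val s x = v}

/-- `S` is conflict-free in the AF `(A, R)`. -/
def ConfFree {A : Type u} (R : A → A → Prop) (S : Set A) : Prop :=
  ∀ a ∈ S, ∀ b ∈ S, ¬ R a b

/-- `S` is naive in the AF `(A, R)`. -/
def NaiveExt {A : Type u} (R : A → A → Prop) (S : Set A) : Prop :=
  ConfFree R S ∧ ∀ S' : Set A, ConfFree R S' → ¬ S ⊂ S'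

/-- The argument `a` is defended by `S` in the AF `(A, R)`. -/
def Defends {A : Type u} (R : A → A → Prop) (S : Set A) (a : A) : Prop :=
  ∀ b, R b a → ∃ c ∈ S, R c b

/-- `S` is admissible in the AF `(A, R)`. -/
def AdmissibleExt {A : Type u} (R : A → A → Prop) (S : Set A) : Prop :=
  ConfFree R S ∧ ∀ a ∈ S, Defends R S a

/-- `S` is preferred in the AF `(A, R)`. -/
def PreferredExt {A : Type u} (R : A → A → Prop) (S : Set A) : Prop :=
  AdmissibleExt R S ∧ ∀ S' : Set A, AdmissibleExt R S' → ¬ S ⊂ S'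

/-- The range `S⁺` of `S` in the AF `(A, R)`. -/
def AFRange {A : Type u} (R : A → A → Prop) (S : Set A) : Set A :=
  S ∪ {a | ∃ b ∈ S, R b a}

/-- `S` is stable in the AF `(A, R)`. -/
def StableExt {A : Type u} (R : A → A → Prop) (S : Set A) : Prop :=
  ConfFree R S ∧ ∀ b, b ∉ S → ∃ a ∈ S, R a b

/-- `S` is stage in the AF `(A, R)`. -/
def StageExt {A : Type u} (R : A → A → Prop) (S : Set A) : Prop :=
  ConfFree R S ∧ ∀ S' : Set A, ConfFree R S' → ¬ AFRange R S ⊂ AFRange R S'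

/-- `S` is semi-stable in the AF `(A, R)`. -/
def SemiStableExt {A : Type u} (R : A → A → Prop) (S : Set A) : Prop :=
  AdmissibleExt R S ∧ ∀ S' : Set A, AdmissibleExt R S' → ¬ AFRange R S ⊂ AFRange R S'

/-- `r` is a conflict of the AF `(A, R)`: an unordered pair `{a, b}` with an attack between
`a` and `b` (in either direction). -/
def IsConflict {A : Type u} (R : A → A → Prop) (r : Sym2 A) : Prop :=
  ∃ a b : A, r = s(a, b) ∧ (R a b ∨ R b a)

/-- Valuation of the conflict database `C_F`: one tuple `𝐚` per argument `a`, over the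
attributes `x_r` (`some r`, for conflicts `r`) and the name attribute `n` (`none`), with
`𝐚[n] = a`, `𝐚[x_r] = r` if `a ∈ r`, and `𝐚[x_r] = a` otherwise. -/
noncomputable def confVal {A : Type u} (R : A → A → Prop) (a : A) :
    Option {r : Sym2 A // IsConflict R r} → A ⊕ Sym2 A
  | none => Sum.inl a
  | some r => if a ∈ r.1 then Sum.inr r.1 else Sum.inl a

/-- The dependencies of the conflict database: the FDs `x_r → n` for conflicts `r`. -/
def confDeps {A : Type u} (R : A → A → Prop) :
    Set (Dep (Option {r : Sym2 A // IsConflict R r})) :=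
  {d | ∃ r : {r : Sym2 A // IsConflict R r}, d = Dep.fd [some r] [none]}

/-- Valuation of the defense database `D_F`: attribute `u_b` is `Sum.inl b`, attribute
`v_b` is `Sum.inr b`, and the value `0` is `none`. -/
noncomputable def defVal {A : Type u} (R : A → A → Prop) (a : A) : A ⊕ A → Option A
  | Sum.inl b => if R a b ∨ R b a then some b else none
  | Sum.inr b => if R a b then some b else none

/-- The dependencies of the defense database: the IDs `u_a ⊆ v_a` for `a ∈ A`. -/
def defDeps {A : Type u} (R : A → A → Prop) : Set (Dep (A ⊕ A)) :=
  {d | ∃ a : A, d = Dep.id [Sum.inl a] [Sum.inr a]}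

/-- `r` is a conflict of `(A, R)` on two distinct arguments. -/
def AFConflict {A : Type u} (R : A → A → Prop) (r : Sym2 A) : Prop :=
  ∃ a b : A, r = s(a, b) ∧ a ≠ b ∧ (R a b ∨ R b a)

/-- Attributes of the AF-database `A_F`: `x_r` for conflicts `r` on distinct arguments, the
name attribute `n`, the defense attributes `u_a, v_a` for `a ∈ A`, and `u_s, v_s`. -/
abbrev AFAttr (A : Type u) (R : A → A → Prop) :=
  ({r : Sym2 A // AFConflict R r} ⊕ Unit) ⊕ ((A ⊕ A) ⊕ (Unit ⊕ Unit))

/-- Valuation of the AF-database `A_F`; the fresh value `0` is `none`. -/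
noncomputable def afVal {A : Type u} (R : A → A → Prop) (a : A) :
    AFAttr A R → Option (A ⊕ Sym2 A)
  | Sum.inl (Sum.inl r) => if a ∈ r.1 then some (Sum.inr r.1) else some (Sum.inl a)
  | Sum.inl (Sum.inr _) => some (Sum.inl a)
  | Sum.inr (Sum.inl (Sum.inl b)) =>
      if a ≠ b ∧ (R a b ∨ R b a) then some (Sum.inl b) else none
  | Sum.inr (Sum.inl (Sum.inr b)) =>
      if a ≠ b ∧ R a b then some (Sum.inl b) else none
  | Sum.inr (Sum.inr (Sum.inl _)) => if R a a then some (Sum.inl a) else none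
  | Sum.inr (Sum.inr (Sum.inr _)) => none

/-- The FDs `x_r → n` of the AF-database. -/
def afFDs (A : Type u) (R : A → A → Prop) : Set (Dep (AFAttr A R)) :=
  {d | ∃ r : {r : Sym2 A // AFConflict R r},
    d = Dep.fd [Sum.inl (Sum.inl r)] [Sum.inl (Sum.inr ())]}

/-- The IDs `u_a ⊆ v_a` of the AF-database. -/
def afIDs (A : Type u) (R : A → A → Prop) : Set (Dep (AFAttr A R)) :=
  {d | ∃ a : A, d = Dep.id [Sum.inr (Sum.inl (Sum.inl a))] [Sum.inr (Sum.inl (Sum.inr a))]}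

/-- The ID `i_s = (u_s ⊆ v_s)` for self-attacking arguments. -/
def afIs (A : Type u) (R : A → A → Prop) : Dep (AFAttr A R) :=
  Dep.id [Sum.inr (Sum.inr (Sum.inl ()))] [Sum.inr (Sum.inr (Sum.inr ()))]

/-- All dependencies `F ∪ I ∪ {i_s}` of the AF-database. -/
def afDeps (A : Type u) (R : A → A → Prop) : Set (Dep (AFAttr A R)) :=
  afFDs A R ∪ afIDs A R ∪ {afIs A R}

/-- The range attributes `X_r = {v_a : a ∈ A} ∪ {n}`. -/
def rangeAttrs (A : Type u) (R : A → A → Prop) : Set (AFAttr A R) :=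
  {x | (∃ a : A, x = Sum.inr (Sum.inl (Sum.inr a))) ∨ x = Sum.inl (Sum.inr ())}

/-- The repairs of the AF-database are exactly the admissible sets. -/
theorem isRepair_afVal_iff_admissibleExt {A : Type u} (R : A → A → Prop) (S : Set A) :
    IsRepair (afVal R) Set.univ (afDeps A R) S ↔ AdmissibleExt R S := by
  constructor
  · rintro ⟨-, h⟩
    have hself : ∀ a ∈ S, ¬ R a a := by
      intro a ha haa
      obtain ⟨t, -, ht⟩ := h (afIs A R) (Or.inr rfl) a ha
      simp [afVal, haa] at ht
    refine ⟨fun a ha b hb hab => ?_, fun a ha b hba => ?_⟩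
    · have hne : a ≠ b := by
        rintro rfl
        exact hself a ha hab
      have := h _ (Or.inl (Or.inl ⟨⟨s(a, b), a, b, rfl, hne, Or.inl hab⟩, rfl⟩)) a ha b hb
        (by simp [afVal])
      simp only [afVal, List.map_cons, List.map_nil, List.cons.injEq, Option.some.injEq,
        Sum.inl.injEq, and_true] at this
      exact hne this
    · have hne : a ≠ b := by
        rintro rfl
        exact hself a ha hba
      obtain ⟨t, ht, htb⟩ := h _ (Or.inl (Or.inr ⟨b, rfl⟩)) a ha
      refine ⟨t, ht, ?_⟩
      by_contra hR
      simp [afVal, hne, hba, hR] at htb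
  · rintro ⟨hcf, hdef⟩
    refine ⟨Set.subset_univ S, ?_⟩
    rintro d ((⟨⟨r, a, b, rfl, -, hab⟩, rfl⟩ | ⟨b, rfl⟩) | rfl)
    · intro s hs t ht hst
      have h₁ := hcf s hs t ht
      have h₂ := hcf t ht s hs
      simp only [afVal, List.map_cons, List.map_nil, List.cons.injEq, and_true,
        Sym2.mem_iff] at hst ⊢
      grind
    · intro s hs
      by_cases hsb : s ≠ b ∧ (R s b ∨ R b s)
      · obtain ⟨t, ht, htb⟩ : ∃ t ∈ S, R t b :=
          hsb.2.elim (fun h => ⟨s, hs, h⟩) (hdef s hs b)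
        have htne : t ≠ b := by
          rintro rfl
          exact hcf t ht t ht htb
        exact ⟨t, ht, by simp [afVal, hsb, htb, htne]⟩
      · refine ⟨s, hs, ?_⟩
        have hsb' : ¬ (s ≠ b ∧ R s b) := fun h => hsb ⟨h.1, Or.inl h.2⟩
        simp only [afVal, List.map_cons, List.map_nil, if_neg hsb, if_neg hsb']
    · intro s hs
      exact ⟨s, hs, by simp [afVal, hcf s hs s hs]⟩

/-- The names covered on the range attributes form the range; the value `0` is covered as
soon as the set is nonempty. -/
theorem domOn_rangeAttrs {A : Type u} (R : A → A → Prop) (S : Set A) :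
    domOn (afVal R) S (rangeAttrs A R) =
      {v | (v = none ∧ S.Nonempty) ∨ ∃ a ∈ AFRange R S, v = some (Sum.inl a)} := by
  ext v
  constructor
  · rintro ⟨s, hs, x, ⟨a, rfl⟩ | rfl, rfl⟩
    · by_cases h : s ≠ a ∧ R s a
      · exact Or.inr ⟨a, Or.inr ⟨s, hs, h.2⟩, if_pos h⟩
      · exact Or.inl ⟨if_neg h, s, hs⟩
    · exact Or.inr ⟨s, Or.inl hs, rfl⟩
  · rintro (⟨rfl, s, hs⟩ | ⟨a, ha, rfl⟩)
    · exact ⟨s, hs, _, Or.inl ⟨s, rfl⟩, by simp [afVal]⟩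
    · by_cases haS : a ∈ S
      · exact ⟨a, haS, _, Or.inr rfl, rfl⟩
      · obtain ⟨b, hb, hba⟩ := ha.resolve_left haS
        have hne : b ≠ a := by
          rintro rfl
          exact haS hb
        exact ⟨b, hb, _, Or.inl ⟨a, rfl⟩, if_pos ⟨hne, hba⟩⟩

theorem domOn_rangeAttrs_subset_iff {A : Type u} (R : A → A → Prop) (S S' : Set A) :
    domOn (afVal R) S (rangeAttrs A R) ⊆ domOn (afVal R) S' (rangeAttrs A R) ↔
      AFRange R S ⊆ AFRange R S' := by
  rw [domOn_rangeAttrs, domOn_rangeAttrs]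
  constructor
  · intro h a ha
    simpa using h (Or.inr ⟨a, ha, rfl⟩)
  · rintro h v (⟨rfl, s, hs⟩ | ⟨a, ha, rfl⟩)
    · refine Or.inl ⟨rfl, ?_⟩
      rcases h (Or.inl hs) with hs' | ⟨b, hb, -⟩
      · exact ⟨s, hs'⟩
      · exact ⟨b, hb⟩
    · exact Or.inr ⟨a, h ha, rfl⟩

/-- For an AF `F = (A, R)` and its AF-database
`A_F = ⟨T, F ∪ I ∪ {i_s}⟩`: a set `S ⊆ A` is semi-stable in `F` iff the corresponding
set of tuples `S_T` is a maximally covering repair of `A_F` with respect to the range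
attributes `X_r` (a repair such that no repair `P'` of `A_F` has
`dom(P'[X_r]) ⊋ dom(S_T[X_r])`). -/
theorem semiStable_iff_maxCoveringRepair {A : Type u} [Fintype A] [Nonempty A]
    (R : A → A → Prop) (S : Set A) :
    SemiStableExt R S ↔
      (IsRepair (afVal R) Set.univ (afDeps A R) S ∧
        ∀ P' : Set A, IsRepair (afVal R) Set.univ (afDeps A R) P' →
          ¬ domOn (afVal R) S (rangeAttrs A R) ⊂ domOn (afVal R) P' (rangeAttrs A R)) := by
  simp only [SemiStableExt, isRepair_afVal_iff_admissibleExt, ssubset_iff_subset_not_subset,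
    domOn_rangeAttrs_subset_iff]
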